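/- Let 𝒜 be a set of probability measures on Ω^∞. There exists an anonymous cardinal comparison test that is ideal with respect to 𝒜 if and only if 𝒜 is pairwise mutually singular, i.e., every two distinct measures in 𝒜 are mutually singular. -/

import Mathlib

open MeasureTheory Filter Set
open scoped ENNReal

/-- The space Ω^∞ of infinite binary sequences. -/
abbrev BinSeq : Type := ℕ → Bool

/-- The cylinder set `[ω^t]` of sequences agreeing with `ω` in the first `t` coordinates. -/
def cyl (ω : BinSeq) (t : ℕ) : Set BinSeq := {ω' | ∀ i < t, ω' i = ω i}

/-- A (candidate) cardinal comparison test: to each ordered pair of measures, each time `t`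
and each realization `ω` it assigns a number. -/
abbrev Test : Type := Measure BinSeq → Measure BinSeq → ℕ → BinSeq → ℝ

/-- The σ-algebra on `BinSeq` generated by the first `t` coordinates. -/
def coordAlg (t : ℕ) : MeasurableSpace BinSeq :=
  MeasurableSpace.comap (fun ω (i : Fin t) => ω (i : ℕ)) inferInstance

/-- A cardinal comparison test: values in `[0,1]`, and `T_t` is measurable with respect to the
σ-algebra generated by the first `t` coordinates, for every `t ≥ 1`. -/
def IsCCTest (T : Test) : Prop :=
  ∀ f g : Measure BinSeq, IsProbabilityMeasure f → IsProbabilityMeasure g →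
    ∀ t : ℕ, 1 ≤ t →
      (∀ ω, T f g t ω ∈ Set.Icc (0:ℝ) 1) ∧ @Measurable BinSeq ℝ (coordAlg t) _ (T f g t)

/-- `L_{T,ε}^{(f,g)}`: the set of `ω` where `lim_t T_t(ω,f,g)` exists and is `> ε`. -/
def LSet (T : Test) (f g : Measure BinSeq) (ε : ℝ) : Set BinSeq :=
  {ω | ∃ l : ℝ, Tendsto (fun t => T f g t ω) atTop (nhds l) ∧ ε < l}

/-- `R_{T,ε}^{(f,g)}`: the set of `ω` where `lim_t T_t(ω,f,g)` exists and is `< ε`. -/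
def RSet (T : Test) (f g : Measure BinSeq) (ε : ℝ) : Set BinSeq :=
  {ω | ∃ l : ℝ, Tendsto (fun t => T f g t ω) atTop (nhds l) ∧ l < ε}

/-- Anonymity: `T_t(ω,f,g) = 1 - T_t(ω,g,f)`. -/
def Anonymous (T : Test) : Prop :=
  ∀ f g : Measure BinSeq, IsProbabilityMeasure f → IsProbabilityMeasure g →
    ∀ t : ℕ, 1 ≤ t → ∀ ω, T f g t ω = 1 - T g f t ω

/-- Error-freeness. -/
def ErrorFree (T : Test) : Prop :=
  ∀ f g : Measure BinSeq, IsProbabilityMeasure f → IsProbabilityMeasure g →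
    ∀ A : Set BinSeq, MeasurableSet A →
      (∀ ε : ℝ, ε ∈ Set.Ioo 0 (1/2) →
        f (A ∩ RSet T f g ε) ≤ ENNReal.ofReal (ε / (1 - ε)) * g (A ∩ RSet T f g ε)) ∧
      (∀ ε : ℝ, ε ∈ Set.Ioo (1/2) 1 →
        g (A ∩ LSet T f g ε) ≤ ENNReal.ofReal ((1 - ε) / ε) * f (A ∩ LSet T f g ε))

/-- Reasonableness. -/
def Reasonable (T : Test) : Prop :=
  ∀ f g : Measure BinSeq, IsProbabilityMeasure f → IsProbabilityMeasure g →
    ∀ A : Set BinSeq, MeasurableSet A →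
      (∀ ε : ℝ, ε ∈ Set.Ioo 0 (1/2) →
        0 < g A → f A < ENNReal.ofReal (ε / (1 - ε)) * g A →
          0 < g (A ∩ RSet T f g ε)) ∧
      (∀ ε : ℝ, ε ∈ Set.Ioo (1/2) 1 →
        0 < f A → g A < ENNReal.ofReal ((1 - ε) / ε) * f A →
          0 < f (A ∩ LSet T f g ε))

/-- The finite derivative test `D`. -/
noncomputable def Dtest : Test := fun f g t ω =>
  match t with
  | 0 => 1/2
  | Nat.succ s =>
      if 0 < f (cyl ω s) + g (cyl ω s) then
        (f (cyl ω s)).toReal / ((f (cyl ω s)).toReal + (g (cyl ω s)).toReal)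
      else 1/2


/-- A test is ideal with respect to a set `𝒜` of (probability) measures if whenever the two
experts use distinct measures from `𝒜`, each surely believes the test will be decisive on
himself. -/
def IdealWrt (T : Test) (𝒜 : Set (Measure BinSeq)) : Prop :=
  ∀ f g : Measure BinSeq, f ∈ 𝒜 → g ∈ 𝒜 → f ≠ g →
    f {ω | Tendsto (fun t => T f g t ω) atTop (nhds 1)} = 1 ∧
    g {ω | Tendsto (fun t => T f g t ω) atTop (nhds 0)} = 1

lemma coordAlg_mono : Monotone coordAlg := by
  intro s t hst
  rw [coordAlg, MeasurableSpace.comap_le_iff_le_map]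
  refine @measurable_pi_lambda _ _ _ (coordAlg t) _ _ fun i => ?_
  have h : @Measurable _ _ (coordAlg t) _ (fun ω : BinSeq => fun j : Fin t => ω j) :=
    comap_measurable _
  exact (measurable_pi_apply (⟨i, i.2.trans_le hst⟩ : Fin t)).comp h

lemma coordAlg_le (t : ℕ) : coordAlg t ≤ MeasurableSpace.pi := by
  have h : Measurable fun (ω : BinSeq) (i : Fin t) => ω i :=
    measurable_pi_lambda _ fun i => measurable_pi_apply (i : ℕ)
  exact h.comap_le

lemma iSup_coordAlg : ⨆ t, coordAlg t = MeasurableSpace.pi := by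
  refine le_antisymm (iSup_le coordAlg_le) (iSup_le fun i => ?_)
  refine le_trans ?_ (le_iSup coordAlg (i + 1))
  rw [MeasurableSpace.comap_le_iff_le_map]
  have h : @Measurable _ _ (coordAlg (i + 1)) _ (fun ω : BinSeq => fun j : Fin (i + 1) => ω j) :=
    comap_measurable _
  exact (measurable_pi_apply (Fin.last i)).comp h

/-- The filtration of `BinSeq` by the σ-algebras of finitely many initial coordinates. -/
def coordFiltration : Filtration ℕ (MeasurableSpace.pi : MeasurableSpace BinSeq) where
  seq := coordAlg
  mono' := coordAlg_mono
  le' := coordAlg_le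

/-- Every measurable set is the limit, almost everywhere for a finite measure, of an adapted
sequence of functions with values in `[0, 1]`. -/
lemma exists_adapted_tendsto_indicator (μ : Measure BinSeq) [IsFiniteMeasure μ] {s : Set BinSeq}
    (hs : MeasurableSet s) :
    ∃ u : ℕ → BinSeq → ℝ, (∀ t, Measurable[coordAlg t] (u t)) ∧ (∀ t ω, u t ω ∈ Icc (0 : ℝ) 1) ∧
      ∀ᵐ ω ∂μ, Tendsto (fun t => u t ω) atTop (nhds (s.indicator 1 ω)) := by
  refine ⟨fun t ω => max 0 (min 1 ((μ[s.indicator (1 : BinSeq → ℝ) | coordAlg t]) ω)),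
    fun t => ?_, fun t ω => ⟨le_max_left _ _, max_le zero_le_one (min_le_left _ _)⟩, ?_⟩
  · have h : Measurable[coordAlg t] (μ[s.indicator (1 : BinSeq → ℝ) | coordAlg t]) :=
      stronglyMeasurable_condExp.measurable
    exact (measurable_const.max (measurable_const.min measurable_id)).comp h
  · have hint : Integrable (s.indicator (1 : BinSeq → ℝ)) μ := (integrable_const 1).indicator hs
    have hmeas : StronglyMeasurable[⨆ t, coordFiltration t] (s.indicator (1 : BinSeq → ℝ)) := by
      change StronglyMeasurable[⨆ t, coordAlg t] _
      rw [iSup_coordAlg]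
      exact stronglyMeasurable_one.indicator hs
    filter_upwards [hint.tendsto_ae_condExp hmeas] with ω hω
    have hlim := tendsto_const_nhds (x := (0 : ℝ)) |>.max
      ((tendsto_const_nhds (x := (1 : ℝ))).min hω)
    convert hlim using 1
    congr 1
    by_cases h : ω ∈ s <;> simp [h]

/-- Two mutually singular finite measures are separated by an adapted sequence of functions with
values in `[0, 1]`. -/
lemma exists_adapted_separating (f g : Measure BinSeq) :
    ∃ u : ℕ → BinSeq → ℝ, (∀ t, Measurable[coordAlg t] (u t)) ∧ (∀ t ω, u t ω ∈ Icc (0 : ℝ) 1) ∧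
      (IsFiniteMeasure f → IsFiniteMeasure g → f ⟂ₘ g →
        (∀ᵐ ω ∂f, Tendsto (fun t => u t ω) atTop (nhds 1)) ∧
        ∀ᵐ ω ∂g, Tendsto (fun t => u t ω) atTop (nhds 0)) := by
  by_cases h : IsFiniteMeasure f ∧ IsFiniteMeasure g ∧ f ⟂ₘ g
  · obtain ⟨hf, hg, s, hs, hfs, hgs⟩ := h
    obtain ⟨u, hu, hu01, hlim⟩ := exists_adapted_tendsto_indicator (f + g) hs.compl
    rw [ae_add_measure_iff] at hlim
    refine ⟨u, hu, hu01, fun _ _ _ => ⟨?_, ?_⟩⟩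
    · filter_upwards [hlim.1, measure_eq_zero_iff_ae_notMem.1 hfs] with ω hω hωs
      simpa [hωs] using hω
    · filter_upwards [hlim.2, measure_eq_zero_iff_ae_notMem.1 hgs] with ω hω hωs
      simpa [not_not.1 hωs] using hω
  · exact ⟨fun _ _ => 0, fun _ => measurable_const, fun _ _ => by simp,
      fun hf hg hfg => (h ⟨hf, hg, hfg⟩).elim⟩

lemma IsCCTest.measurableSet_tendsto {T : Test} (hT : IsCCTest T) (f g : Measure BinSeq)
    [IsProbabilityMeasure f] [IsProbabilityMeasure g] (l : ℝ) :
    MeasurableSet {ω | Tendsto (fun t => T f g t ω) atTop (nhds l)} := by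
  simp_rw [← tendsto_add_atTop_iff_nat (f := fun t => T f g t _) 1]
  exact _root_.measurableSet_tendsto _ fun t =>
    (hT f g inferInstance inferInstance (t + 1) (Nat.le_add_left 1 t)).2.mono
      (coordAlg_le _) le_rfl

/-- Existence of an anonymous ideal test with respect to `𝒜` is equivalent to `𝒜` being
pairwise mutually singular. -/
theorem stmt17 (𝒜 : Set (Measure BinSeq)) (h𝒜 : ∀ μ ∈ 𝒜, IsProbabilityMeasure μ) :
    (∃ T : Test, IsCCTest T ∧ Anonymous T ∧ IdealWrt T 𝒜) ↔
      ∀ f ∈ 𝒜, ∀ g ∈ 𝒜, f ≠ g → f ⟂ₘ g := by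
  constructor
  · rintro ⟨T, hT, -, hideal⟩ f hf g hg hfg
    have := h𝒜 f hf
    have := h𝒜 g hg
    obtain ⟨h1, h0⟩ := hideal f g hf hg hfg
    have hm := hT.measurableSet_tendsto f g
    refine Measure.MutuallySingular.mk ((prob_compl_eq_zero_iff (hm 1)).2 h1)
      ((prob_compl_eq_zero_iff (hm 0)).2 h0) fun ω _ => ?_
    by_contra! hω
    simp only [mem_union, mem_compl_iff, not_or, not_not] at hω
    exact one_ne_zero (tendsto_nhds_unique hω.1 hω.2)
  · intro hsing
    choose u hu hu01 hlim using exists_adapted_separating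
    refine ⟨fun f g t ω => (u f g t ω + (1 - u g f t ω)) / 2, ?_, ?_, ?_⟩
    · intro f g _ _ t _
      refine ⟨fun ω => ?_, ((hu f g t).add ((hu g f t).const_sub 1)).div_const 2⟩
      obtain ⟨h1, h2⟩ := hu01 f g t ω
      obtain ⟨h3, h4⟩ := hu01 g f t ω
      constructor <;> linarith
    · intro f g _ _ t _ ω
      ring
    · intro f g hf hg hfg
      have := h𝒜 f hf
      have := h𝒜 g hg
      obtain ⟨hf1, hg0⟩ := hlim f g inferInstance inferInstance (hsing f hf g hg hfg)
      obtain ⟨hg1, hf0⟩ := hlim g f inferInstance inferInstance (hsing g hg f hf hfg.symm)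
      refine ⟨(measure_congr (eventuallyEq_univ.2 ?_)).trans measure_univ, (measure_congr (eventuallyEq_univ.2 ?_)).trans measure_univ⟩
      · filter_upwards [hf1, hf0] with ω h1 h0
        simpa using (h1.add (h0.const_sub 1)).div_const 2
      · filter_upwards [hg1, hg0] with ω h1 h0
        simpa using (h0.add (h1.const_sub 1)).div_const 2
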